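/- Let s₁,…,s_m be subsets of the n sites and let ψ be a unit vector in the n-qubit space such that ψψ† is UDA by its reduced density matrices on s₁,…,s_m, and such that the tuple ((ψψ†)_{s₁},…,(ψψ†)_{s_m}) is an exposed point of ℛ (there is a continuous real-linear functional on the tuple space attaining its strict maximum over ℛ exactly at this tuple). Then there exist Hermitian matrices hᵢ indexed by (sᵢ → Fin 2) such that, for H = Σᵢ₌₁^m lift(hᵢ,sᵢ), every n-qubit density matrix ρ minimizing re Tr(Hρ) over all n-qubit density matrices equals ψψ†; in particular ψψ† is itself such a minimizer, so ψ is the unique ground state of the local Hamiltonian H with interaction graph {s₁,…,s_m}. -/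

import Mathlib

open Matrix
open scoped ComplexOrder

/-- The type of configurations of `n` qubits. -/
abbrev QConf (n : ℕ) := Fin n → Fin 2

/-- An `n`-qubit matrix. -/
abbrev QMatrix (n : ℕ) := Matrix (QConf n) (QConf n) ℂ

/-- Combine a configuration `f` on the sites in `s` with a configuration `h` on the
complementary sites into a configuration on all `n` sites. -/
def mergeConf {n : ℕ} (s : Finset (Fin n)) (f : ↥s → Fin 2) (h : ↥sᶜ → Fin 2) :
    QConf n :=
  fun i => if hi : i ∈ s then f ⟨i, hi⟩ else h ⟨i, Finset.mem_compl.mpr hi⟩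

/-- The reduced density matrix of an `n`-qubit matrix `ρ` on the subset `s` of sites
(partial trace over the complement of `s`). -/
noncomputable def reduce {n : ℕ} (ρ : QMatrix n) (s : Finset (Fin n)) :
    Matrix (↥s → Fin 2) (↥s → Fin 2) ℂ :=
  fun f g => ∑ h : ↥sᶜ → Fin 2, ρ (mergeConf s f h) (mergeConf s g h)

/-- The lift of a matrix `h` on the sites in `s` to an `n`-qubit matrix:
`h` tensored with the identity on the complement of `s`. -/
def liftMat {n : ℕ} (s : Finset (Fin n)) (h : Matrix (↥s → Fin 2) (↥s → Fin 2) ℂ) :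
    QMatrix n :=
  fun F G =>
    if ∀ i : ↥sᶜ, F i = G i then h (fun i : ↥s => F i) (fun i : ↥s => G i) else 0

/-- `ρ` is a density matrix: positive semidefinite with trace 1. -/
def IsDensityMatrix {d : Type*} [Fintype d] (ρ : Matrix d d ℂ) : Prop :=
  ρ.PosSemidef ∧ ρ.trace = 1

/-- The convex set `ℛ` of tuples of reduced density matrices on the subsets
`s 0, …, s (m-1)`, as `ρ` ranges over all `n`-qubit density matrices. -/
noncomputable def RSet (n m : ℕ) (s : Fin m → Finset (Fin n)) :
    Set (∀ i : Fin m, Matrix (↥(s i) → Fin 2) (↥(s i) → Fin 2) ℂ) :=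
  {t | ∃ ρ : QMatrix n, IsDensityMatrix ρ ∧ ∀ i, reduce ρ (s i) = t i}

/-- Splitting a configuration into its parts on `s` and on the complement of `s`. -/
def mergeConfEquiv {n : ℕ} (s : Finset (Fin n)) :
    (↥s → Fin 2) × (↥sᶜ → Fin 2) ≃ QConf n where
  toFun p := mergeConf s p.1 p.2
  invFun F := (fun i => F i, fun i => F i)
  left_inv p := by
    refine Prod.ext (funext fun i => ?_) (funext fun i => ?_)
    · simp [mergeConf]
    · simp [mergeConf, Finset.mem_compl.mp i.2]
  right_inv F := by
    funext i
    simp [mergeConf]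

lemma liftMat_mergeConf {n : ℕ} (s : Finset (Fin n))
    (h : Matrix (↥s → Fin 2) (↥s → Fin 2) ℂ) (f g : ↥s → Fin 2) (k l : ↥sᶜ → Fin 2) :
    liftMat s h (mergeConf s f k) (mergeConf s g l) = if k = l then h f g else 0 := by
  have hres (f : ↥s → Fin 2) (k : ↥sᶜ → Fin 2) : (fun i : ↥s => mergeConf s f k i) = f :=
    congrArg Prod.fst ((mergeConfEquiv s).left_inv (f, k))
  have hcompl (f : ↥s → Fin 2) (k : ↥sᶜ → Fin 2) (i : ↥sᶜ) : mergeConf s f k i = k i :=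
    congrFun (congrArg Prod.snd ((mergeConfEquiv s).left_inv (f, k))) i
  simp only [liftMat, hres, hcompl, funext_iff]

/-- The lift is adjoint to the partial trace for the trace pairing. -/
lemma trace_liftMat_mul {n : ℕ} (s : Finset (Fin n))
    (h : Matrix (↥s → Fin 2) (↥s → Fin 2) ℂ) (ρ : QMatrix n) :
    (liftMat s h * ρ).trace = (h * reduce ρ s).trace := by
  simp only [Matrix.trace, Matrix.diag, Matrix.mul_apply]
  simp only [← (mergeConfEquiv s).sum_comp]
  change ∑ p : (↥s → Fin 2) × (↥sᶜ → Fin 2), ∑ q : (↥s → Fin 2) × (↥sᶜ → Fin 2),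
    liftMat s h (mergeConf s p.1 p.2) (mergeConf s q.1 q.2) *
      ρ (mergeConf s q.1 q.2) (mergeConf s p.1 p.2) = _
  simp only [liftMat_mergeConf, Fintype.sum_prod_type, ite_mul, zero_mul, Finset.sum_ite_eq,
    Finset.mem_univ, if_true, reduce, Finset.mul_sum]
  exact Finset.sum_congr rfl fun f _ => Finset.sum_comm

lemma reduce_isHermitian {n : ℕ} {ρ : QMatrix n} (hρ : ρ.IsHermitian) (s : Finset (Fin n)) :
    (reduce ρ s).IsHermitian := by
  ext f g
  simp [reduce, Matrix.conjTranspose_apply, hρ.apply]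

/-- Every real-linear functional on complex matrices is the real trace pairing with some matrix. -/
lemma exists_re_trace_mul_eq {d : Type*} [Fintype d] [DecidableEq d]
    (φ : Matrix d d ℂ →ₗ[ℝ] ℝ) :
    ∃ K : Matrix d d ℂ, ∀ M : Matrix d d ℂ, φ M = ((K * M).trace).re := by
  refine ⟨Matrix.of fun j i =>
      φ (Matrix.single i j 1) - Complex.I * φ (Matrix.single i j Complex.I),
    fun M => ?_⟩
  have hentry (i j : d) : Matrix.single i j (M i j) =
      (M i j).re • Matrix.single i j (1 : ℂ) + (M i j).im • Matrix.single i j Complex.I := by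
    rw [Matrix.smul_single, Matrix.smul_single, ← Matrix.single_add]
    congr 1
    simp [Complex.re_add_im]
  conv_lhs => rw [Matrix.matrix_eq_sum_single M]
  simp only [map_sum, hentry, map_add, map_smul, Matrix.trace, Matrix.diag, Matrix.mul_apply,
    Complex.re_sum]
  rw [Finset.sum_comm]
  refine Finset.sum_congr rfl fun j _ => Finset.sum_congr rfl fun i _ => ?_
  simp
  ring

/-- On Hermitian matrices, every real-linear functional is the real trace pairing with some
Hermitian matrix. -/
lemma exists_isHermitian_re_trace_mul_eq {d : Type*} [Fintype d] [DecidableEq d]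
    (φ : Matrix d d ℂ →ₗ[ℝ] ℝ) :
    ∃ h : Matrix d d ℂ, h.IsHermitian ∧
      ∀ M : Matrix d d ℂ, M.IsHermitian → φ M = ((h * M).trace).re := by
  obtain ⟨K, hK⟩ := exists_re_trace_mul_eq φ
  refine ⟨(2⁻¹ : ℝ) • (K + Kᴴ), ?_, fun M hM => ?_⟩
  · rw [Matrix.IsHermitian, Matrix.conjTranspose_smul, Matrix.conjTranspose_add,
      Matrix.conjTranspose_conjTranspose, add_comm, star_trivial]
  · have hadj : ((Kᴴ * M).trace).re = ((K * M).trace).re := by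
      have : (Kᴴ * M).trace = star (K * M).trace := by
        rw [← Matrix.trace_conjTranspose, Matrix.conjTranspose_mul, hM.eq, Matrix.trace_mul_comm]
      rw [this]
      exact Complex.conj_re _
    rw [hK M, Matrix.smul_mul, Matrix.trace_smul, Complex.smul_re, Matrix.add_mul,
      Matrix.trace_add, Complex.add_re, hadj, smul_eq_mul]
    ring

lemma isDensityMatrix_vecMulVec {d : Type*} [Fintype d] {ψ : d → ℂ} (hψ : star ψ ⬝ᵥ ψ = 1) :
    IsDensityMatrix (vecMulVec ψ (star ψ)) :=
  ⟨Matrix.posSemidef_vecMulVec_self_star ψ, by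
    rw [Matrix.trace_vecMulVec, dotProduct_comm, hψ]⟩

/-- Every real-linear functional of the reduced density matrices is the energy of a Hamiltonian
with Hermitian local terms. -/
lemma exists_local_hamiltonian {n m : ℕ} (s : Fin m → Finset (Fin n))
    (φ : (∀ i : Fin m, Matrix (↥(s i) → Fin 2) (↥(s i) → Fin 2) ℂ) →ₗ[ℝ] ℝ) :
    ∃ h : ∀ i : Fin m, Matrix (↥(s i) → Fin 2) (↥(s i) → Fin 2) ℂ,
      (∀ i, (h i).IsHermitian) ∧
      ∀ ρ : QMatrix n, ρ.IsHermitian →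
        (((∑ i, liftMat (s i) (h i)) * ρ).trace).re = φ fun i => reduce ρ (s i) := by
  choose h hh hφ using fun i => exists_isHermitian_re_trace_mul_eq
    (φ ∘ₗ LinearMap.single ℝ (fun i => Matrix (↥(s i) → Fin 2) (↥(s i) → Fin 2) ℂ) i)
  refine ⟨h, hh, fun ρ hρ => ?_⟩
  rw [Finset.sum_mul, Matrix.trace_sum, Complex.re_sum,
    ← Finset.univ_sum_single (fun i => reduce ρ (s i)), map_sum]
  refine Finset.sum_congr rfl fun i _ => ?_
  rw [trace_liftMat_mul, ← hφ i _ (reduce_isHermitian hρ (s i))]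
  rfl

/-- If `ψψ†` is UDA by its reduced density matrices on `s 0, …, s (m-1)`
and the tuple of these reduced density matrices is an exposed point of `ℛ`, then there
exist Hermitian local terms `hᵢ` such that, for `H = Σᵢ lift(hᵢ,sᵢ)`, every density
matrix minimizing `re Tr(Hρ)` over all density matrices equals `ψψ†`, and `ψψ†` is
itself such a minimizer; i.e. `ψ` is the unique ground state of the local Hamiltonian
`H` with interaction graph `{s₁,…,s_m}`. -/
theorem unique_ground_state_of_UDA_exposed
    (n m : ℕ) (s : Fin m → Finset (Fin n))
    (ψ : QConf n → ℂ) (hψ : star ψ ⬝ᵥ ψ = 1)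
    (hUDA : ∀ ρ : QMatrix n, IsDensityMatrix ρ →
      (∀ i, reduce ρ (s i) = reduce (vecMulVec ψ (star ψ)) (s i)) →
      ρ = vecMulVec ψ (star ψ))
    (hexp : (fun i => reduce (vecMulVec ψ (star ψ)) (s i)) ∈
      Set.exposedPoints ℝ (RSet n m s)) :
    ∃ hmat : ∀ i : Fin m, Matrix (↥(s i) → Fin 2) (↥(s i) → Fin 2) ℂ,
      (∀ i, (hmat i).IsHermitian) ∧
      (∀ ρ : QMatrix n, IsDensityMatrix ρ →
        (∀ σ : QMatrix n, IsDensityMatrix σ →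
          (((∑ i, liftMat (s i) (hmat i)) * ρ).trace).re ≤
            (((∑ i, liftMat (s i) (hmat i)) * σ).trace).re) →
        ρ = vecMulVec ψ (star ψ)) ∧
      (∀ σ : QMatrix n, IsDensityMatrix σ →
        (((∑ i, liftMat (s i) (hmat i)) * vecMulVec ψ (star ψ)).trace).re ≤
          (((∑ i, liftMat (s i) (hmat i)) * σ).trace).re) := by
  obtain ⟨-, l, hl⟩ := hexp
  obtain ⟨h, hh, hH⟩ := exists_local_hamiltonian s (-(l : _ →ₗ[ℝ] ℝ))
  have hψd := isDensityMatrix_vecMulVec hψ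
  refine ⟨h, hh, fun ρ hρ hmin => hUDA ρ hρ fun i => ?_, fun σ hσ => ?_⟩
  · have hle := hmin _ hψd
    rw [hH _ hρ.1.isHermitian, hH _ hψd.1.isHermitian] at hle
    exact congrFun ((hl _ ⟨ρ, hρ, fun _ => rfl⟩).2 (neg_le_neg_iff.mp hle)) i
  · rw [hH _ hσ.1.isHermitian, hH _ hψd.1.isHermitian]
    exact neg_le_neg (hl _ ⟨σ, hσ, fun _ => rfl⟩).1
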